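/- Let K be an algebraically closed field of characteristic p ≥ 3 and b1, …, b5 ∈ K such that h(X) = X^5 + b1*X^4 + b2*X^3 + b3*X^2 + b4*X + b5 is squarefree. Let f1, …, f6 be the Grant polynomials and U = {z ∈ K^8 : f1(z) = … = f6(z) = 0}. For a point P ∈ U write its coordinates as (z11(P), z12(P), z22(P), z111(P), z112(P), z122(P), z222(P), z(P)), and for R ∈ U define the function 𝔮_R on U by 𝔮_R(Q) = z11(Q) − z11(R) + z12(Q)·z22(R) − z12(R)·z22(Q). Let ι : K^8 → K^8 be the map negating the coordinates Z111, Z112, Z122, Z222 and fixing Z11, Z12, Z22, Z (this is the Jacobian group inverse on U). If R, R' ∈ U satisfy R ≠ R' and R ≠ ι(R'), then the set {Q ∈ U : 𝔮_R(Q) = 0 and 𝔮_{R'}(Q) = 0} is finite of cardinality at most 20. -/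

import Mathlib

set_option linter.unusedVariables false

open MvPolynomial in
/-- Grant polynomial `f1 = 2Z − Z11·Z22 + Z12² − b2·Z12 + b4`.
Variables: `0 = Z11, 1 = Z12, 2 = Z22, 3 = Z111, 4 = Z112, 5 = Z122, 6 = Z222, 7 = Z`. -/
noncomputable def grantF1 {R : Type*} [CommRing R] (b1 b2 b3 b4 b5 : R) :
    MvPolynomial (Fin 8) R :=
  2 * X 7 - X 0 * X 2 + X 1 ^ 2 - C b2 * X 1 + C b4

open MvPolynomial in
/-- Grant polynomial `f2 = Z112 − Z222·Z12 + Z122·Z22`. -/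
noncomputable def grantF2 {R : Type*} [CommRing R] (b1 b2 b3 b4 b5 : R) :
    MvPolynomial (Fin 8) R :=
  X 4 - X 6 * X 1 + X 5 * X 2

open MvPolynomial in
/-- Grant polynomial `f3 = Z111 + Z222·Z11 + Z122·Z12 − 2Z112·Z22 − 2b1·Z112 + b2·Z122`. -/
noncomputable def grantF3 {R : Type*} [CommRing R] (b1 b2 b3 b4 b5 : R) :
    MvPolynomial (Fin 8) R :=
  X 3 + X 6 * X 0 + X 5 * X 1 - 2 * X 4 * X 2 - 2 * C b1 * X 4 + C b2 * X 5

open MvPolynomial in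
/-- Grant polynomial `f4 = Z122² − Z11·Z22² + 2Z·Z22 + Z11·Z12 − b1·Z11·Z22 − b2·Z12·Z22
+ 2b1·Z − b1·b2·Z12 + b4·Z22 + b1·b4 − b5`. -/
noncomputable def grantF4 {R : Type*} [CommRing R] (b1 b2 b3 b4 b5 : R) :
    MvPolynomial (Fin 8) R :=
  X 5 ^ 2 - X 0 * X 2 ^ 2 + 2 * X 7 * X 2 + X 0 * X 1 - C b1 * X 0 * X 2
    - C b2 * X 1 * X 2 + 2 * C b1 * X 7 - C b1 * C b2 * X 1 + C b4 * X 2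
    + C (b1 * b4) - C b5

open MvPolynomial in
/-- Grant polynomial `f5 = Z222² − Z22³ − Z12·Z22 − b1·Z22² − Z11 − b2·Z22 − b3`. -/
noncomputable def grantF5 {R : Type*} [CommRing R] (b1 b2 b3 b4 b5 : R) :
    MvPolynomial (Fin 8) R :=
  X 6 ^ 2 - X 2 ^ 3 - X 1 * X 2 - C b1 * X 2 ^ 2 - X 0 - C b2 * X 2 - C b3

open MvPolynomial in
/-- Grant polynomial `f6 = Z122·Z222 − Z12·Z22² + Z − b2·Z12 − b1·Z12·Z22`. -/
noncomputable def grantF6 {R : Type*} [CommRing R] (b1 b2 b3 b4 b5 : R) :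
    MvPolynomial (Fin 8) R :=
  X 5 * X 6 - X 1 * X 2 ^ 2 + X 7 - C b2 * X 1 - C b1 * X 1 * X 2

/-- The list of the six Grant polynomials cutting out the affine part `U` of the
Jacobian of the genus 2 curve `Y² = X⁵ + b1·X⁴ + b2·X³ + b3·X² + b4·X + b5`. -/
noncomputable def grantPolys {R : Type*} [CommRing R] (b1 b2 b3 b4 b5 : R) :
    List (MvPolynomial (Fin 8) R) :=
  [grantF1 b1 b2 b3 b4 b5, grantF2 b1 b2 b3 b4 b5, grantF3 b1 b2 b3 b4 b5,
   grantF4 b1 b2 b3 b4 b5, grantF5 b1 b2 b3 b4 b5, grantF6 b1 b2 b3 b4 b5]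

/-- The bilinear expression `𝔮(Q,R) = z11(Q) − z11(R) + z12(Q)·z22(R) − z12(R)·z22(Q)`
on points of `K⁸` (coordinates `0 = Z11, 1 = Z12, 2 = Z22, …, 7 = Z`). -/
def grantQ {K : Type*} [Field K] (Q R : Fin 8 → K) : K :=
  Q 0 - R 0 + Q 1 * R 2 - R 1 * Q 2

/-- The inverse map of the Jacobian group law in the Grant coordinates: it negates the
coordinates `Z111, Z112, Z122, Z222` (indices `3, 4, 5, 6`) and fixes `Z11, Z12, Z22, Z`
(indices `0, 1, 2, 7`). -/
def grantNeg {K : Type*} [Field K] (z : Fin 8 → K) : Fin 8 → K :=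
  fun i => if i = 3 ∨ i = 4 ∨ i = 5 ∨ i = 6 then -z i else z i

section GrantAux
open Polynomial

lemma grantAux_finalA {K : Type*} [Field K] (h : K[X]) (hsf : Squarefree h)
    (t0 t1 l m g1 g0 : K)
    (hid : (X + C t1) ^ 3 * h = ((X ^ 2 - C t0) - C l * (X + C t1)) *
      (((X ^ 2 - C t0) - C m * (X + C t1)) * X
        + (C g1 * (X ^ 2 - C t0) + C g0 * (X + C t1))) ^ 2) : False := by
  have hP : Prime (X + C t1 : K[X]) := by
    have := Polynomial.prime_X_sub_C (-t1); simpa using this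
  have hM : ((((X ^ 2 - C t0) - C m * (X + C t1)) * X
        + (C g1 * (X ^ 2 - C t0) + C g0 * (X + C t1)) : K[X])).natDegree = 3 := by
    compute_degree!
  have hPd : (X + C t1 : K[X]).natDegree = 1 := natDegree_X_add_C t1
  have key : ∀ M' q : K[X], h = q * M' ^ 2 → M'.natDegree = 0 := by
    intro M' q e
    exact natDegree_eq_zero_of_isUnit (hsf M' ⟨q, by rw [e]; ring⟩)
  have hP0 : (X + C t1 : K[X]) ≠ 0 := hP.ne_zero
  generalize hN : (X ^ 2 - C t0 : K[X]) = N at *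
  generalize hPP : (X + C t1 : K[X]) = P at *
  by_cases hd : P ∣ N
  · obtain ⟨N', rfl⟩ := hd
    have e : h = (N' - C l) * ((N' - C m) * X + (C g1 * N' + C g0)) ^ 2 := by
      apply mul_left_cancel₀ (pow_ne_zero 3 hP0)
      rw [hid]; ring
    have k := key _ _ e
    have e2 : (P * N' - C m * P) * X + (C g1 * (P * N') + C g0 * P)
      = P * ((N' - C m) * X + (C g1 * N' + C g0)) := by ring
    rw [e2] at hM
    have := natDegree_mul_le (p := P) (q := ((N' - C m) * X + (C g1 * N' + C g0)))
    omega
  · generalize hMM : (N - C m * P) * X + (C g1 * N + C g0 * P) = M at *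
    have hd1 : ¬ P ∣ N - C l * P := fun hc => hd ((dvd_sub_left (dvd_mul_left P (C l))).1 hc)
    have h1 : P ∣ M := by
      have : P ∣ (N - C l * P) * M ^ 2 := by rw [← hid]; exact ⟨P ^ 2 * h, by ring⟩
      exact hP.dvd_of_dvd_pow ((hP.dvd_or_dvd this).resolve_left hd1)
    obtain ⟨M1, rfl⟩ := h1
    have e1 : P * h = (N - C l * P) * M1 ^ 2 := by
      apply mul_left_cancel₀ (pow_ne_zero 2 hP0)
      linear_combination hid
    have h2 : P ∣ M1 := by
      have : P ∣ (N - C l * P) * M1 ^ 2 := by rw [← e1]; exact ⟨h, by ring⟩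
      exact hP.dvd_of_dvd_pow ((hP.dvd_or_dvd this).resolve_left hd1)
    obtain ⟨M2, rfl⟩ := h2
    have e2 : h = ((N - C l * P) * P) * M2 ^ 2 := by
      apply mul_left_cancel₀ hP0
      linear_combination e1
    have k := key _ _ e2
    have := natDegree_mul_le (p := P) (q := P * M2)
    have := natDegree_mul_le (p := P) (q := M2)
    omega

lemma grantAux_finalB {K : Type*} [Field K] (h : K[X]) (hsf : Squarefree h)
    (P N : K[X]) (hP : Prime P) (hPd : P.natDegree = 1)
    (e2 e1 e0 k : K)
    (hid : P ^ 3 * h = (N ^ 3 + C e2 * N ^ 2 * P + C e1 * N * P ^ 2 + C e0 * P ^ 3) *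
      (X + C k) ^ 2) : False := by
  have hP0 : P ≠ 0 := hP.ne_zero
  by_cases hd : P ∣ N
  · obtain ⟨N', rfl⟩ := hd
    have e : h = (N' ^ 3 + C e2 * N' ^ 2 + C e1 * N' + C e0) * (X + C k) ^ 2 := by
      apply mul_left_cancel₀ (pow_ne_zero 3 hP0)
      rw [hid]; ring
    have := natDegree_eq_zero_of_isUnit (hsf (X + C k) ⟨_, by rw [e, mul_comm, pow_two]⟩)
    rw [natDegree_X_add_C] at this
    omega
  · have hc : ¬ P ∣ (N ^ 3 + C e2 * N ^ 2 * P + C e1 * N * P ^ 2 + C e0 * P ^ 3) := by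
      intro hc
      apply hd
      apply hP.dvd_of_dvd_pow (n := 3)
      have : N ^ 3 + C e2 * N ^ 2 * P + C e1 * N * P ^ 2 + C e0 * P ^ 3
        = N ^ 3 + P * (C e2 * N ^ 2 + C e1 * N * P + C e0 * P ^ 2) := by ring
      rw [this] at hc
      exact (dvd_add_left (dvd_mul_right _ _)).1 hc
    have hdv : P ^ 3 ∣ (X + C k) ^ 2 := by
      have h3 : P ^ 3 ∣ (N ^ 3 + C e2 * N ^ 2 * P + C e1 * N * P ^ 2 + C e0 * P ^ 3) *
        (X + C k) ^ 2 := ⟨h, hid.symm⟩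
      exact hP.pow_dvd_of_dvd_mul_left 3 hc h3
    have hX : (X + C k : K[X]) ≠ 0 := X_add_C_ne_zero k
    have := natDegree_le_of_dvd hdv (pow_ne_zero 2 hX)
    rw [natDegree_pow, natDegree_pow, natDegree_X_add_C, hPd] at this
    omega

lemma grantAux_key {K : Type*} [Field K] [IsAlgClosed K] (h2 : (2 : K) ≠ 0)
    (b1 b2 b3 b4 b5 t0 t1 a0 a1 : K)
    (hsf : Squarefree (X ^ 5 + C b1 * X ^ 4 + C b2 * X ^ 3 + C b3 * X ^ 2 + C b4 * X + C b5 : K[X]))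
    (A B D : K[X])
    (hA : A = X ^ 3 + (C t0 + C t1 * X) * X + C b1 * X ^ 2 + (C a0 + C a1 * X) + C b2 * X + C b3)
    (hB : 2 * B = 2 * X ^ 2 * (C t0 + C t1 * X) + 2 * C b1 * X * (C t0 + C t1 * X)
      + C b2 * (C t0 + C t1 * X) + (C t0 + C t1 * X) ^ 2 - (C a0 + C a1 * X) * X + C b4)
    (hD : D = X * (C t0 + C t1 * X) ^ 2 - (C a0 + C a1 * X) * (C t0 + C t1 * X)
      + C b1 * (C t0 + C t1 * X) ^ 2 + C b5)
    (hABD : A * D = B ^ 2) : False := by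
  have hAm : A.Monic := by rw [hA]; monicity!
  have hAd : A.natDegree = 3 := by rw [hA]; compute_degree!
  have hDd : D.natDegree ≤ 3 := by rw [hD]; compute_degree
  have hP : Prime (X + C t1 : K[X]) := by
    have := Polynomial.prime_X_sub_C (-t1); simpa using this
  have hPd : (X + C t1 : K[X]).natDegree = 1 := natDegree_X_add_C t1
  let L := FractionRing K[X]
  let φ : K[X] →+* L := algebraMap K[X] L
  have hφ : Function.Injective φ := IsFractionRing.injective K[X] L
  have hP0 : φ (X + C t1) ≠ 0 := by
    rw [Ne, map_eq_zero_iff φ hφ]; exact hP.ne_zero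
  let τ : L := φ (X ^ 2 - C t0) / φ (X + C t1)
  have hτ : τ * φ (X + C t1) = φ (X ^ 2 - C t0) := div_mul_cancel₀ _ hP0
  let ψ : K[X] →+* L := eval₂RingHom (φ.comp C) τ
  have hψC : ∀ c, ψ (C c) = φ (C c) := fun c => by simp [ψ]
  have hψX : ψ X = τ := by simp [ψ]
  have main : φ (X ^ 5 + C b1 * X ^ 4 + C b2 * X ^ 3 + C b3 * X ^ 2 + C b4 * X + C b5)
     = ψ A * φ X ^ 2 + 2 * ψ B * φ X + ψ D := by
    have hB' : 2 * ψ B = ψ (2 * B) := by rw [map_mul, map_ofNat]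
    rw [hB', hA, hB, hD]
    simp only [map_add, map_sub, map_mul, map_pow, hψC, hψX, map_ofNat] at hτ ⊢
    generalize φ X = x at *
    generalize φ (C t0) = t0' at *
    generalize φ (C t1) = t1' at *
    generalize φ (C a0) = a0' at *
    generalize φ (C a1) = a1' at *
    generalize φ (C b1) = b1' at *
    generalize φ (C b2) = b2' at *
    generalize φ (C b3) = b3' at *
    generalize φ (C b4) = b4' at *
    generalize φ (C b5) = b5' at *
    linear_combination (-(x ^ 3 + (b1' + τ) * x ^ 2 + (b2' + (t0' + t1' * τ) + b1' * τ + τ ^ 2) * x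
      + (τ * (t0' + t1' * τ) - (a0' + a1' * τ) + b1' * (t0' + t1' * τ)))) * hτ
  by_cases hAs : A ∣ B
  · obtain ⟨c, rfl⟩ := hAs
    have hDe : D = A * c ^ 2 := by
      apply mul_left_cancel₀ hAm.ne_zero
      linear_combination hABD
    have hc : c.natDegree = 0 := by
      by_contra hc
      have hc0 : c ≠ 0 := by rintro rfl; simp at hc
      rw [hDe, natDegree_mul hAm.ne_zero (pow_ne_zero 2 hc0), natDegree_pow] at hDd
      omega
    obtain ⟨k, rfl⟩ := natDegree_eq_zero.1 hc
    apply grantAux_finalB _ hsf (X + C t1) (X ^ 2 - C t0) hP hPd (b1 + t1) (t0 + a1 + b2) (a0 + b3) k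
    apply hφ
    rw [map_mul, main, hDe, map_mul ψ, map_mul ψ, hA]
    simp only [map_add, map_sub, map_mul, map_pow, hψC, hψX] at hτ ⊢
    rw [← hτ]
    ring
  · have hns : ¬ Squarefree A := by
      intro hs
      exact hAs ((hs.dvd_pow_iff_dvd (two_ne_zero)).1 ⟨D, hABD.symm⟩)
    unfold Squarefree at hns
    push Not at hns
    obtain ⟨y, hy, hyu⟩ := hns
    have hyd : y.degree ≠ 0 := fun e => hyu (isUnit_iff_degree_eq_zero.2 e)
    obtain ⟨m, hm⟩ := IsAlgClosed.exists_root y hyd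
    have hmy := dvd_iff_isRoot.2 hm
    obtain ⟨q, hq⟩ := (mul_dvd_mul hmy hmy).trans hy
    have hXm : (X - C m : K[X]).Monic := monic_X_sub_C m
    have hqm : q.Monic := by
      have : ((X - C m : K[X]) * (X - C m)).Monic := hXm.mul hXm
      exact this.of_mul_monic_left (hq ▸ hAm)
    have hqd : q.natDegree = 1 := by
      have := hAd
      rw [hq, (hXm.mul hXm).natDegree_mul hqm, hXm.natDegree_mul hXm, natDegree_X_sub_C] at this
      omega
    obtain ⟨l, rfl⟩ : ∃ l, q = X - C l := by
      refine ⟨-q.coeff 0, ?_⟩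
      have := hqm.eq_X_add_C hqd
      rw [C_neg, sub_neg_eq_add]; exact this
    have hpm := prime_X_sub_C m
    have hpl := prime_X_sub_C l
    have d1 : (X - C m) ∣ B := by
      apply hpm.dvd_of_dvd_pow (n := 2)
      rw [← hABD, hq]; exact ⟨(X - C m) * (X - C l) * D, by ring⟩
    obtain ⟨B1, rfl⟩ := d1
    have e1 : (X - C l) * D = B1 ^ 2 := by
      apply mul_left_cancel₀ (pow_ne_zero 2 hpm.ne_zero)
      rw [hq] at hABD
      linear_combination hABD
    obtain ⟨g, rfl⟩ : (X - C l) ∣ B1 := hpl.dvd_of_dvd_pow (n := 2) ⟨D, e1.symm⟩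
    have e3 : D = (X - C l) * g ^ 2 := by
      apply mul_left_cancel₀ hpl.ne_zero
      linear_combination e1
    have hg : g.natDegree ≤ 1 := by
      by_cases hg0 : g = 0
      · simp [hg0]
      rw [e3, natDegree_mul hpl.ne_zero (pow_ne_zero 2 hg0), natDegree_pow, natDegree_X_sub_C] at hDd
      omega
    obtain ⟨g1, g0, rfl⟩ := exists_eq_X_add_C_of_natDegree_le_one hg
    apply grantAux_finalA _ hsf t0 t1 l m g1 g0
    apply hφ
    rw [map_mul, main, e3, hq]
    simp only [map_add, map_sub, map_mul, map_pow, hψC, hψX] at hτ ⊢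
    rw [← hτ]
    ring


lemma grantAux_mem {K : Type*} [Field K] {b1 b2 b3 b4 b5 : K} {z : Fin 8 → K}
    (hz : ∀ fi ∈ grantPolys b1 b2 b3 b4 b5, MvPolynomial.eval z fi = 0) :
    (2 * z 7 = z 0 * z 2 - z 1 ^ 2 + b2 * z 1 - b4) ∧
    (z 4 = z 6 * z 1 - z 5 * z 2) ∧
    (z 3 = -(z 6 * z 0 + z 5 * z 1 - 2 * z 4 * z 2 - 2 * b1 * z 4 + b2 * z 5)) ∧
    (z 6 ^ 2 = z 2 ^ 3 + z 1 * z 2 + b1 * z 2 ^ 2 + z 0 + b2 * z 2 + b3) ∧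
    (2 * (z 5 * z 6) = 2 * z 2 ^ 2 * z 1 + 2 * b1 * z 2 * z 1 + b2 * z 1 + z 1 ^ 2
      - z 0 * z 2 + b4) ∧
    (z 5 ^ 2 = z 2 * z 1 ^ 2 - z 0 * z 1 + b1 * z 1 ^ 2 + b5) := by
  simp only [grantPolys, List.mem_cons, List.not_mem_nil, or_false, forall_eq_or_imp,
    forall_eq, grantF1, grantF2, grantF3, grantF4, grantF5, grantF6, map_add, map_sub, map_mul,
    map_pow, MvPolynomial.eval_X, MvPolynomial.eval_C, map_ofNat] at hz
  obtain ⟨h1, h2, h3, h4, h5, h6⟩ := hz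
  refine ⟨?_, ?_, ?_, ?_, ?_, ?_⟩
  · linear_combination h1
  · linear_combination h2
  · linear_combination h3
  · linear_combination h5
  · linear_combination 2 * h6 - h1
  · linear_combination h4 - (z 2 + b1) * h1

lemma grantAux_fiber {K : Type*} [Field K] (two : (2 : K) ≠ 0) {b1 b2 b3 b4 b5 : K}
    {z y : Fin 8 → K}
    (hz : ∀ fi ∈ grantPolys b1 b2 b3 b4 b5, MvPolynomial.eval z fi = 0)
    (hy : ∀ fi ∈ grantPolys b1 b2 b3 b4 b5, MvPolynomial.eval y fi = 0)
    (h0 : z 0 = y 0) (h1 : z 1 = y 1) (h2 : z 2 = y 2) : z = y ∨ z = grantNeg y := by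
  obtain ⟨z1, z2, z3, z4, z5, z6⟩ := grantAux_mem hz
  obtain ⟨y1, y2, y3, y4, y5, y6⟩ := grantAux_mem hy
  rw [h0, h1, h2] at z1 z4 z5 z6
  rw [h1, h2] at z2
  rw [h0, h1, h2] at z3
  have e7 : z 7 = y 7 := mul_left_cancel₀ two (z1.trans y1.symm)
  have e66 : z 6 ^ 2 = y 6 ^ 2 := z4.trans y4.symm
  have e56 : z 5 * z 6 = y 5 * y 6 := mul_left_cancel₀ two (z5.trans y5.symm)
  have e55 : z 5 ^ 2 = y 5 ^ 2 := z6.trans y6.symm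
  have hcase : (z 5 = y 5 ∧ z 6 = y 6) ∨ (z 5 = - y 5 ∧ z 6 = - y 6) := by
    rcases sq_eq_sq_iff_eq_or_eq_neg.1 e66 with h | h <;>
      rcases sq_eq_sq_iff_eq_or_eq_neg.1 e55 with h' | h'
    · exact Or.inl ⟨h', h⟩
    · rw [h, h'] at e56
      have : (2 : K) * (y 5 * y 6) = 0 := by linear_combination -e56
      rcases mul_eq_zero.1 ((mul_eq_zero.1 this).resolve_left two) with k | k
      · exact Or.inl ⟨by rw [h', k, neg_zero], h⟩
      · exact Or.inr ⟨h', by rw [h, k, neg_zero]⟩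
    · rw [h, h'] at e56
      have : (2 : K) * (y 5 * y 6) = 0 := by linear_combination -e56
      rcases mul_eq_zero.1 ((mul_eq_zero.1 this).resolve_left two) with k | k
      · exact Or.inr ⟨by rw [h', k, neg_zero], h⟩
      · exact Or.inl ⟨h', by rw [h, k, neg_zero]⟩
    · exact Or.inr ⟨h', h⟩
  rcases hcase with ⟨h5, h6⟩ | ⟨h5, h6⟩
  · left
    have h4 : z 4 = y 4 := by rw [z2, y2, h5, h6]
    have h3 : z 3 = y 3 := by rw [z3, y3, h4, h5, h6]
    funext i; fin_cases i <;> assumption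
  · right
    have h4 : z 4 = - y 4 := by rw [z2, y2, h5, h6]; ring
    have h3 : z 3 = - y 3 := by rw [z3, y3, h4, h5, h6]; ring
    funext i; fin_cases i <;> simp [grantNeg] <;> assumption

lemma grantAux_count {K : Type*} [Field K] (S : Set (Fin 8 → K)) (i : Fin 8) (F : K[X])
    (hF : F ≠ 0) (hd : F.natDegree ≤ 10) (hr : ∀ Q ∈ S, F.eval (Q i) = 0)
    (hf : ∀ Q ∈ S, ∀ Q' ∈ S, Q i = Q' i → Q = Q' ∨ Q = grantNeg Q') :
    S.Finite ∧ S.ncard ≤ 20 := by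
  classical
  have hch : ∀ r : K, ∃ T : Finset (Fin 8 → K), T.card ≤ 2 ∧ ∀ Q ∈ S, Q i = r → Q ∈ T := by
    intro r
    by_cases he : ∃ Q ∈ S, Q i = r
    · obtain ⟨Q0, hQ0, rfl⟩ := he
      refine ⟨{Q0, grantNeg Q0}, Finset.card_le_two, fun Q hQ e => ?_⟩
      simpa using hf Q hQ Q0 hQ0 e
    · exact ⟨∅, by simp, fun Q hQ e => (he ⟨Q, hQ, e⟩).elim⟩
  choose T hT hTm using hch
  have hsub : S ⊆ ((F.roots.toFinset.biUnion T : Finset (Fin 8 → K)) : Set (Fin 8 → K)) := by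
    intro Q hQ
    simp only [Finset.coe_biUnion, Set.mem_iUnion, Finset.mem_coe]
    exact ⟨Q i, by simpa [hF] using hr Q hQ, hTm _ Q hQ rfl⟩
  refine ⟨(Finset.finite_toSet _).subset hsub, ?_⟩
  have h1 := Set.ncard_le_ncard hsub (Finset.finite_toSet _)
  rw [Set.ncard_coe_finset] at h1
  have h2 := Finset.card_biUnion_le_card_mul F.roots.toFinset T 2 (fun r _ => hT r)
  have h3 := F.roots.toFinset_card_le
  have h4 := F.card_roots'
  omega

end GrantAux

open MvPolynomial Polynomial in
/-- Over an algebraically closed field `K` of characteristic `p ≥ 3`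
with `h(X) = X⁵ + b1·X⁴ + b2·X³ + b3·X² + b4·X + b5` squarefree, let `U ⊆ K⁸` be the
common zero set of the six Grant polynomials. If `R, R' ∈ U` with `R ≠ R'` and
`R ≠ ι(R')` (where `ι` is the Jacobian inverse), then the common zero set in `U` of
`𝔮_R` and `𝔮_{R'}` is finite with at most `20` elements. -/
theorem stmt_5 {K : Type*} [Field K] [IsAlgClosed K] (p : ℕ) [CharP K p] (hp : 3 ≤ p)
    (b1 b2 b3 b4 b5 : K)
    (hsf : Squarefree (Polynomial.X ^ 5 + Polynomial.C b1 * Polynomial.X ^ 4 +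
      Polynomial.C b2 * Polynomial.X ^ 3 + Polynomial.C b3 * Polynomial.X ^ 2 +
      Polynomial.C b4 * Polynomial.X + Polynomial.C b5 : Polynomial K))
    (U : Set (Fin 8 → K))
    (hU : U = {z : Fin 8 → K | ∀ fi ∈ grantPolys b1 b2 b3 b4 b5, eval z fi = 0})
    (R R' : Fin 8 → K) (hR : R ∈ U) (hR' : R' ∈ U)
    (hne : R ≠ R') (hne' : R ≠ grantNeg R') :
    {Q ∈ U | grantQ Q R = 0 ∧ grantQ Q R' = 0}.Finite ∧
      {Q ∈ U | grantQ Q R = 0 ∧ grantQ Q R' = 0}.ncard ≤ 20 := by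
  have two : (2 : K) ≠ 0 := by
    intro h
    have h' : ((2 : ℕ) : K) = 0 := by exact_mod_cast h
    rw [CharP.cast_eq_zero_iff K p] at h'
    exact absurd (Nat.le_of_dvd (by norm_num) h') (by omega)
  subst hU
  simp only [Set.mem_ofPred_eq] at hR hR' ⊢
  have hRR : ¬ (R 0 = R' 0 ∧ R 1 = R' 1 ∧ R 2 = R' 2) := by
    rintro ⟨h0, h1, h2⟩
    exact (grantAux_fiber two hR hR' h0 h1 h2).elim hne hne'
  by_cases hs : R 2 = R' 2
  · by_cases ht : R 1 = R' 1
    · have h0 : R 0 ≠ R' 0 := fun h => hRR ⟨h, ht, hs⟩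
      have : {Q : Fin 8 → K | (∀ fi ∈ grantPolys b1 b2 b3 b4 b5, MvPolynomial.eval Q fi = 0) ∧
          grantQ Q R = 0 ∧ grantQ Q R' = 0} = ∅ := by
        ext Q
        simp only [Set.mem_ofPred_eq, Set.mem_empty_iff_false, iff_false]
        rintro ⟨-, h1, h2⟩
        apply h0
        simp only [grantQ] at h1 h2
        rw [hs, ht] at h1
        linear_combination h2 - h1
      rw [this]; simp
    · have ht' : R 1 - R' 1 ≠ 0 := sub_ne_zero.2 ht
      obtain ⟨s0, hs0⟩ : ∃ s0, s0 * (R 1 - R' 1) = R' 0 - R 0 :=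
        ⟨(R' 0 - R 0) / (R 1 - R' 1), div_mul_cancel₀ _ ht'⟩
      have hQs : ∀ Q : Fin 8 → K, grantQ Q R = 0 → grantQ Q R' = 0 →
          Q 2 = s0 ∧ Q 0 = (R 0 + R 1 * s0) + (- R 2) * Q 1 := by
        intro Q h1 h2
        simp only [grantQ] at h1 h2
        have : Q 2 = s0 := by
          apply mul_right_cancel₀ ht'
          rw [← hs] at h2
          linear_combination h2 - h1 - hs0
        refine ⟨this, ?_⟩
        rw [← this]
        linear_combination h1
      generalize R 0 + R 1 * s0 = a0 at hQs
      generalize - R 2 = a1 at hQs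
      have hdeg : (4 * (Polynomial.C (s0 + a1) * Polynomial.X + Polynomial.C (s0 ^ 3 + b1 * s0 ^ 2 + a0 + b2 * s0 + b3)) *
          (Polynomial.C (s0 - a1 + b1) * Polynomial.X ^ 2 + Polynomial.C (- a0) * Polynomial.X + Polynomial.C b5)
          - (Polynomial.X ^ 2 + Polynomial.C (2 * s0 ^ 2 + 2 * b1 * s0 + b2 - a1 * s0) * Polynomial.X
            + Polynomial.C (b4 - a0 * s0)) ^ 2 : Polynomial K).natDegree = 4 := by
        compute_degree!
      refine grantAux_count _ 1 _ ?_ (hdeg.trans_le (by norm_num)) ?_ ?_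
      · intro h; rw [h] at hdeg; simp at hdeg
      · rintro Q ⟨hQ, h1, h2⟩
        obtain ⟨e2, e0⟩ := hQs Q h1 h2
        obtain ⟨-, -, -, z4, z5, z6⟩ := grantAux_mem hQ
        rw [e0, e2] at z4 z5 z6
        have c1 : (s0 + a1) * Q 1 + (s0 ^ 3 + b1 * s0 ^ 2 + a0 + b2 * s0 + b3) = Q 6 ^ 2 := by
          rw [z4]; ring
        have c2 : (s0 - a1 + b1) * Q 1 ^ 2 + (- a0) * Q 1 + b5 = Q 5 ^ 2 := by
          rw [z6]; ring
        have c3 : Q 1 ^ 2 + (2 * s0 ^ 2 + 2 * b1 * s0 + b2 - a1 * s0) * Q 1 + (b4 - a0 * s0)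
            = 2 * (Q 5 * Q 6) := by
          rw [z5]; ring
        simp only [Polynomial.eval_sub, Polynomial.eval_mul, Polynomial.eval_pow, Polynomial.eval_add,
          Polynomial.eval_X, Polynomial.eval_C, Polynomial.eval_ofNat]
        rw [c1, c2, c3]; ring
      · rintro Q ⟨hQ, h1, h2⟩ Q' ⟨hQ', h1', h2'⟩ e
        obtain ⟨e2, e0⟩ := hQs Q h1 h2
        obtain ⟨e2', e0'⟩ := hQs Q' h1' h2'
        exact grantAux_fiber two hQ hQ' (by rw [e0, e0', e]) e (by rw [e2, e2'])
  · have hs' : R 2 - R' 2 ≠ 0 := sub_ne_zero.2 hs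
    obtain ⟨t0, ht0⟩ : ∃ t0, t0 * (R 2 - R' 2) = R 0 - R' 0 :=
      ⟨(R 0 - R' 0) / (R 2 - R' 2), div_mul_cancel₀ _ hs'⟩
    obtain ⟨t1, ht1⟩ : ∃ t1, t1 * (R 2 - R' 2) = R 1 - R' 1 :=
      ⟨(R 1 - R' 1) / (R 2 - R' 2), div_mul_cancel₀ _ hs'⟩
    have hQs : ∀ Q : Fin 8 → K, grantQ Q R = 0 → grantQ Q R' = 0 →
        Q 1 = t0 + t1 * Q 2 ∧ Q 0 = (R 0 - R 2 * t0) + (R 1 - R 2 * t1) * Q 2 := by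
      intro Q h1 h2
      simp only [grantQ] at h1 h2
      have : Q 1 = t0 + t1 * Q 2 := by
        apply mul_right_cancel₀ hs'
        linear_combination h1 - h2 - ht0 - Q 2 * ht1
      refine ⟨this, ?_⟩
      rw [this] at h1
      linear_combination h1
    generalize R 0 - R 2 * t0 = a0 at hQs
    generalize R 1 - R 2 * t1 = a1 at hQs
    let T : Polynomial K := Polynomial.C t0 + Polynomial.C t1 * Polynomial.X
    let a : Polynomial K := Polynomial.C a0 + Polynomial.C a1 * Polynomial.X
    let A : Polynomial K := Polynomial.X ^ 3 + T * Polynomial.X + Polynomial.C b1 * Polynomial.X ^ 2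
      + a + Polynomial.C b2 * Polynomial.X + Polynomial.C b3
    let B2 : Polynomial K := 2 * Polynomial.X ^ 2 * T + 2 * Polynomial.C b1 * Polynomial.X * T
      + Polynomial.C b2 * T + T ^ 2 - a * Polynomial.X + Polynomial.C b4
    let D : Polynomial K := Polynomial.X * T ^ 2 - a * T + Polynomial.C b1 * T ^ 2 + Polynomial.C b5
    refine grantAux_count _ 2 (4 * (A * D) - B2 ^ 2) ?_ ?_ ?_ ?_
    · intro h
      have h22 : (2 : Polynomial K) * Polynomial.C (2⁻¹) = 1 := by
        rw [← map_ofNat (Polynomial.C (R := K)) 2, ← Polynomial.C_mul, mul_inv_cancel₀ two,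
          Polynomial.C_1]
      have hb : 2 * (Polynomial.C (2⁻¹) * B2) = B2 := by rw [← mul_assoc, h22, one_mul]
      refine grantAux_key two b1 b2 b3 b4 b5 t0 t1 a0 a1 hsf A (Polynomial.C (2⁻¹) * B2) D
        rfl hb rfl ?_
      linear_combination (Polynomial.C (2⁻¹)) ^ 2 * h
        - (A * D) * (2 * Polynomial.C (2⁻¹) + 1) * h22
    · have hTd : T.natDegree ≤ 1 := by simp only [T]; compute_degree
      have had : a.natDegree ≤ 1 := by simp only [a]; compute_degree
      have hA : A.natDegree ≤ 3 := by simp only [A, T, a]; compute_degree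
      have hB : B2.natDegree ≤ 3 := by simp only [B2, T, a]; compute_degree
      have hD : D.natDegree ≤ 3 := by simp only [D, T, a]; compute_degree
      have h4 : (4 : Polynomial K).natDegree = 0 := Polynomial.natDegree_ofNat 4
      have m1 := Polynomial.natDegree_mul_le (p := (4 : Polynomial K)) (q := A * D)
      have m2 := Polynomial.natDegree_mul_le (p := A) (q := D)
      have m3 := Polynomial.natDegree_pow_le (p := B2) (n := 2)
      have m4 := Polynomial.natDegree_sub_le (4 * (A * D)) (B2 ^ 2)
      omega
    · rintro Q ⟨hQ, h1, h2⟩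
      obtain ⟨e1, e0⟩ := hQs Q h1 h2
      obtain ⟨-, -, -, z4, z5, z6⟩ := grantAux_mem hQ
      have hT : T.eval (Q 2) = Q 1 := by simp [T, e1]
      have ha : a.eval (Q 2) = Q 0 := by simp [a, e0]
      have c1 : A.eval (Q 2) = Q 6 ^ 2 := by
        simp only [A, Polynomial.eval_mul, Polynomial.eval_pow,
          Polynomial.eval_add, Polynomial.eval_X, Polynomial.eval_C, hT, ha, z4]
      have c2 : D.eval (Q 2) = Q 5 ^ 2 := by
        simp only [D, Polynomial.eval_sub, Polynomial.eval_mul, Polynomial.eval_pow,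
          Polynomial.eval_add, Polynomial.eval_X, Polynomial.eval_C, hT, ha, z6]
      have c3 : B2.eval (Q 2) = 2 * (Q 5 * Q 6) := by
        simp only [B2, Polynomial.eval_sub, Polynomial.eval_mul, Polynomial.eval_pow,
          Polynomial.eval_add, Polynomial.eval_X, Polynomial.eval_C, Polynomial.eval_ofNat,
          hT, ha, z5]
      simp only [Polynomial.eval_sub, Polynomial.eval_mul, Polynomial.eval_pow,
        Polynomial.eval_ofNat]
      rw [c1, c2, c3]; ring
    · rintro Q ⟨hQ, h1, h2⟩ Q' ⟨hQ', h1', h2'⟩ e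
      obtain ⟨e1, e0⟩ := hQs Q h1 h2
      obtain ⟨e1', e0'⟩ := hQs Q' h1' h2'
      exact grantAux_fiber two hQ hQ' (by rw [e0, e0', e]) (by rw [e1, e1', e]) e
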